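/- arXiv:1605.02758 — 2 statements merged into one kernel-verified Lean document; each statement's English description precedes it below -/
import Mathlib

section
/- Let a group G act without inversion on locally finite pocsets P and P', let f : P → P' be a G-equivariant resolution of pocsets, let h₁, h₂ ∈ P be an elementary foldable pair for f, and let ∼ be the smallest G-invariant and *-invariant equivalence relation on P with h₁ ∼ h₂. Then for every hyperplane ĥ of P there is a choice of one orientation of each hyperplane in the ∼-class [ĥ] such that the chosen halfspaces are pairwise facing; in particular every ∼-class of hyperplanes is a facing collection of hyperplanes. -/
/- Pocsets, hyperplanes, admissible equivalence relations, quotients,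
   admissible maps, embeddings, resolutions, group actions on pocsets,
   elementary folds and folding sequences. -/

universe u v w

/-- A pocset: a poset with an order-reversing involution `star` such that
`h ≠ h *` and `h`, `h *` are incomparable. -/
structure Pocset (P : Type u) where
  le : P → P → Prop
  star : P → P
  le_refl : ∀ a, le a a
  le_trans : ∀ {a b c}, le a b → le b c → le a c
  le_antisymm : ∀ {a b}, le a b → le b a → a = b
  star_star : ∀ a, star (star a) = a
  star_antitone : ∀ {a b}, le a b → le (star b) (star a)
  ne_star : ∀ a, a ≠ star a
  not_le_star : ∀ a, ¬ le a (star a)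
  not_star_le : ∀ a, ¬ le (star a) a

namespace Pocset

variable {P : Type u} {P' : Type v}

/-- Strict order. -/
def lt (Q : Pocset P) (a b : P) : Prop := Q.le a b ∧ a ≠ b

/-- The orientations of the hyperplane `ĥ` determined by the halfspace `h`. -/
def orient (Q : Pocset P) (h : P) : Set P := {h, Q.star h}

/-- `k` is an orientation of the same hyperplane as `h`, i.e. `k̂ = ĥ`. -/
def sameHyp (Q : Pocset P) (h k : P) : Prop := k = h ∨ k = Q.star h

/-- The hyperplanes `ĥ` and `k̂` are transverse: they are distinct and no
orientation of `ĥ` is comparable with any orientation of `k̂`. -/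
def transverse (Q : Pocset P) (h k : P) : Prop :=
  ¬ Q.sameHyp h k ∧ ∀ a ∈ Q.orient h, ∀ b ∈ Q.orient k, ¬ Q.le a b ∧ ¬ Q.le b a

/-- Two hyperplanes are disjoint if they are distinct and not transverse. -/
def disjointHyp (Q : Pocset P) (h k : P) : Prop :=
  ¬ Q.sameHyp h k ∧ ¬ Q.transverse h k

/-- The halfspaces `h` and `k` are facing: `h* < k`. -/
def facing (Q : Pocset P) (h k : P) : Prop := Q.lt (Q.star h) k

/-- The halfspaces `h` and `k` are compatible: not `k ≤ h*`. -/
def compatible (Q : Pocset P) (h k : P) : Prop := ¬ Q.le k (Q.star h)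

/-- The hyperplane `k̂` separates the hyperplanes `ĥ` and `l̂`: there are
orientations with `a < b < c`. -/
def separates (Q : Pocset P) (k h l : P) : Prop :=
  ∃ a ∈ Q.orient h, ∃ b ∈ Q.orient k, ∃ c ∈ Q.orient l, Q.lt a b ∧ Q.lt b c

/-- Local finiteness: every interval is finite. -/
def LocallyFinite (Q : Pocset P) : Prop :=
  ∀ a b : P, {c : P | Q.le a c ∧ Q.le c b}.Finite

/-- The equivalence relation induced on hyperplanes by a relation `r` on
halfspaces: `ĥ ∼ k̂` iff `h ∼ k` or `h ∼ k*`. -/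
def hypRel (Q : Pocset P) (r : P → P → Prop) (h k : P) : Prop :=
  r h k ∨ r h (Q.star k)

/-- An admissible equivalence relation on a pocset. -/
structure IsAdmissible (Q : Pocset P) (r : P → P → Prop) : Prop where
  equiv : Equivalence r
  aer1 : ∀ h, ¬ r h (Q.star h)
  aer2 : ∀ h k, r h k → r (Q.star h) (Q.star k)
  aer3 : ∀ h k, Q.transverse h k → ¬ r h k
  aer4 : ∀ h k, Q.hypRel r h k → ¬ Q.sameHyp h k →
    (∀ m, Q.hypRel r h m → ¬ Q.separates m h k) →
    ∀ a ∈ Q.orient h, ∀ b ∈ Q.orient k, Q.facing a b → r a b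

/-- The strict quotient relation: `[h] < [k]` iff `[h] ≠ [k]`, every pair of
representatives has disjoint hyperplanes, and `h' < k'` for every pair of
representatives whose hyperplanes are `([ĥ] ∪ [k̂])`-inseparable. -/
def QuotLT (Q : Pocset P) (r : P → P → Prop) (h k : P) : Prop :=
  ¬ r h k ∧
  (∀ h' k', r h h' → r k k' → Q.disjointHyp h' k') ∧
  (∀ h' k', r h h' → r k k' →
    (∀ m, (Q.hypRel r h m ∨ Q.hypRel r k m) → ¬ Q.separates m h' k') → Q.lt h' k')

/-- The quotient relation: `[h] ≤ [k]` iff `[h] = [k]` or `[h] < [k]`. -/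
def QuotLE (Q : Pocset P) (r : P → P → Prop) (h k : P) : Prop :=
  r h k ∨ Q.QuotLT r h k

/-- Transversality of `[ĥ]` and `[k̂]` in the quotient pocset. -/
def QuotTransverse (Q : Pocset P) (r : P → P → Prop) (h k : P) : Prop :=
  ¬ Q.hypRel r h k ∧
  ∀ a ∈ Q.orient h, ∀ b ∈ Q.orient k, ¬ Q.QuotLE r a b ∧ ¬ Q.QuotLE r b a

/-- `[k̂]` separates `[ĥ]` and `[l̂]` in the quotient pocset. -/
def QuotSeparates (Q : Pocset P) (r : P → P → Prop) (k h l : P) : Prop :=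
  ∃ a ∈ Q.orient h, ∃ b ∈ Q.orient k, ∃ c ∈ Q.orient l,
    Q.QuotLT r a b ∧ Q.QuotLT r b c

/-- `[h]` and `[k]` are facing in the quotient pocset: `[h]* < [k]`. -/
def QuotFacing (Q : Pocset P) (r : P → P → Prop) (h k : P) : Prop :=
  Q.QuotLT r (Q.star h) k

/-- An admissible map of pocsets. -/
structure IsAdmissibleMap (Q : Pocset P) (Q' : Pocset P') (f : P → P') : Prop where
  am1 : ∀ h, f (Q.star h) = Q'.star (f h)
  am2 : ∀ h k, Q.transverse h k → Q'.transverse (f h) (f k)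
  am3 : ∀ h k, Q.facing h k → Q'.sameHyp (f h) (f k) →
    (∀ m, Q'.sameHyp (f m) (f h) → ¬ Q.separates m h k) → f h = f k
  am4 : ∀ h' : P', (∀ m : P, ¬ Q'.sameHyp (f m) h') →
    ∃ b ∈ Q'.orient h', ∀ m : P, Q'.compatible b (f m)

/-- An embedding of pocsets: an injective, order-reflecting admissible map. -/
structure IsPocsetEmbedding (Q : Pocset P) (Q' : Pocset P') (f : P → P') : Prop where
  adm : IsAdmissibleMap Q Q' f
  inj : Function.Injective f
  le_reflect : ∀ h k, Q'.le (f h) (f k) → Q.le h k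

/-- The equivalence relation `∼_f` induced by a map `f`. -/
def simRel (f : P → P') : P → P → Prop := fun a b => f a = f b

/-- A resolution of pocsets: an admissible map `f` such that `∼_f` is an
admissible equivalence relation and the induced map `P/∼_f → P'` is an
embedding of pocsets (stated here on representatives: `quot_am2` and
`quot_am3` are admissibility of the induced map, `le_reflect` is
order-reflection; injectivity of the induced map is automatic, and its
properties (AM1) and (AM4) coincide with those of `f`). -/
structure IsResolution (Q : Pocset P) (Q' : Pocset P') (f : P → P') : Prop where
  adm : IsAdmissibleMap Q Q' f
  aer : Q.IsAdmissible (simRel f)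
  quot_am2 : ∀ h k, Q.QuotTransverse (simRel f) h k → Q'.transverse (f h) (f k)
  quot_am3 : ∀ h k, Q.QuotFacing (simRel f) h k → Q'.sameHyp (f h) (f k) →
    (∀ m, Q'.sameHyp (f m) (f h) → ¬ Q.QuotSeparates (simRel f) m h k) → f h = f k
  le_reflect : ∀ h k, Q'.le (f h) (f k) → Q.QuotLE (simRel f) h k

/-- A group `G` acts (without inversion) on the pocset `Q` by order-preserving
bijections commuting with `star`. -/
structure IsGAction (Q : Pocset P) (G : Type w) [Group G] [MulAction G P] : Prop where
  smul_le : ∀ (g : G) (a b : P), Q.le a b → Q.le (g • a) (g • b)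
  smul_star : ∀ (g : G) (a : P), g • Q.star a = Q.star (g • a)
  no_inversion : ∀ (g : G) (a : P), g • a ≠ Q.star a

/-- `G`-equivariance of a map. -/
def Equivariant (G : Type w) [Group G] [MulAction G P] [MulAction G P']
    (f : P → P') : Prop :=
  ∀ (g : G) (a : P), f (g • a) = g • f a

/-- An elementary foldable pair for a resolution `f`: facing halfspaces with
`f h₁ = f h₂`, whose hyperplanes are `f⁻¹(f(ĥ₁))`-inseparable, such that no
pair of distinct `∼_f`-equivalent hyperplanes both separate `ĥ₁` and `ĥ₂`. -/
def ElemFoldable (Q : Pocset P) (Q' : Pocset P') (f : P → P') (h₁ h₂ : P) : Prop :=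
  Q.facing h₁ h₂ ∧ f h₁ = f h₂ ∧
  (∀ m, Q'.sameHyp (f m) (f h₁) → ¬ Q.separates m h₁ h₂) ∧
  (∀ m m', Q'.sameHyp (f m) (f m') → ¬ Q.sameHyp m m' →
    ¬ (Q.separates m h₁ h₂ ∧ Q.separates m' h₁ h₂))

/-- `r` is the smallest `G`-invariant and `star`-invariant equivalence
relation with `h₁ ∼ h₂`. -/
structure IsFoldRel (Q : Pocset P) (G : Type w) [Group G] [MulAction G P]
    (h₁ h₂ : P) (r : P → P → Prop) : Prop where
  equiv : Equivalence r
  ginv : ∀ (g : G) (a b : P), r a b → r (g • a) (g • b)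
  sinv : ∀ a b, r a b → r (Q.star a) (Q.star b)
  base : r h₁ h₂
  min : ∀ s : P → P → Prop, Equivalence s →
    (∀ (g : G) (a b : P), s a b → s (g • a) (g • b)) →
    (∀ a b, s a b → s (Q.star a) (Q.star b)) → s h₁ h₂ →
    ∀ a b, r a b → s a b

/-- `[h₁]`, `[h₂]` is an elementary foldable pair in the quotient pocset
`P/r` for the resolution induced by `f` on `P/r`. -/
def QuotElemFoldable (Q : Pocset P) (Q' : Pocset P') (f : P → P')
    (r : P → P → Prop) (h₁ h₂ : P) : Prop :=
  Q.QuotFacing r h₁ h₂ ∧ f h₁ = f h₂ ∧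
  (∀ m, Q'.sameHyp (f m) (f h₁) → ¬ Q.QuotSeparates r m h₁ h₂) ∧
  (∀ m m', Q'.sameHyp (f m) (f m') → ¬ Q.hypRel r m m' →
    ¬ (Q.QuotSeparates r m h₁ h₂ ∧ Q.QuotSeparates r m' h₁ h₂))

/-- `r'` is (the pullback to `P` of) the smallest `G`-invariant and
`star`-invariant equivalence relation on `P/r` identifying `[h₁] ∼ [h₂]`,
i.e. the smallest `G`-invariant, `star`-invariant equivalence relation on `P`
containing `r` with `h₁ ∼ h₂`. -/
structure IsFoldStepRel (Q : Pocset P) (G : Type w) [Group G] [MulAction G P]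
    (r : P → P → Prop) (h₁ h₂ : P) (r' : P → P → Prop) : Prop where
  equiv : Equivalence r'
  mono : ∀ a b, r a b → r' a b
  ginv : ∀ (g : G) (a b : P), r' a b → r' (g • a) (g • b)
  sinv : ∀ a b, r' a b → r' (Q.star a) (Q.star b)
  base : r' h₁ h₂
  min : ∀ s : P → P → Prop, Equivalence s → (∀ a b, r a b → s a b) →
    (∀ (g : G) (a b : P), s a b → s (g • a) (g • b)) →
    (∀ a b, s a b → s (Q.star a) (Q.star b)) → s h₁ h₂ →
    ∀ a b, r' a b → s a b

/-- A finite folding sequence `P = P₀ ↝ P₁ ↝ ⋯ ↝ Pₙ` for a `G`-equivariant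
resolution `f : P → P'`, encoded by the sequence of equivalence relations
`rs i` on `P` with `Pᵢ = P / rs i`: `rs 0` is equality, every `rs i` refines
`∼_f`, and each step is an elementary fold (of an elementary foldable pair
for the induced resolution `fᵢ : P/rs i → P'`). -/
def IsFoldingSequence (Q : Pocset P) (Q' : Pocset P') (G : Type w) [Group G]
    [MulAction G P] (f : P → P') (n : ℕ)
    (rs : Fin (n + 1) → (P → P → Prop)) : Prop :=
  (∀ a b : P, rs 0 a b ↔ a = b) ∧
  (∀ (i : Fin (n + 1)) (a b : P), rs i a b → f a = f b) ∧
  (∀ i : Fin n, ∃ h₁ h₂ : P,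
    Q.QuotElemFoldable Q' f (rs i.castSucc) h₁ h₂ ∧
    Q.IsFoldStepRel G (rs i.castSucc) h₁ h₂ (rs i.succ))

end Pocset

namespace Pocset

variable {P : Type u} {P' : Type v} {Q : Pocset P} {Q' : Pocset P'} {f : P → P'}

theorem lt.trans {a b c : P} (hab : Q.lt a b) (hbc : Q.lt b c) : Q.lt a c :=
  ⟨Q.le_trans hab.1 hbc.1, fun h => hab.2 (Q.le_antisymm hab.1 (h ▸ hbc.1))⟩

theorem lt.star {a b : P} (h : Q.lt a b) : Q.lt (Q.star b) (Q.star a) :=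
  ⟨Q.star_antitone h.1, fun e => h.2 (by rw [← Q.star_star a, ← e, Q.star_star])⟩

theorem facing.symm {a b : P} (h : Q.facing a b) : Q.facing b a := by
  simpa only [facing, Q.star_star] using lt.star h

/-- Distinct hyperplanes which are not transverse have comparable orientations. -/
theorem sameHyp_or_lt_of_not_transverse {a b : P} (h : ¬ Q.transverse a b) :
    Q.sameHyp a b ∨ Q.lt a b ∨ Q.lt b a ∨ Q.lt (Q.star a) b ∨ Q.lt b (Q.star a) := by
  by_cases hs : Q.sameHyp a b
  · exact Or.inl hs
  have hs' := hs
  simp only [sameHyp, not_or] at hs'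
  obtain ⟨hne, hne'⟩ := hs'
  have key : Q.le a b ∨ Q.le b a ∨ Q.le (Q.star a) b ∨ Q.le b (Q.star a) := by
    by_contra! hc
    obtain ⟨h1, h2, h3, h4⟩ := hc
    have st : ∀ x y, Q.le (Q.star x) y → Q.le (Q.star y) x := fun x y hxy => by
      simpa only [Q.star_star] using Q.star_antitone hxy
    have ts : ∀ x y, Q.le x (Q.star y) → Q.le y (Q.star x) := fun x y hxy => by
      simpa only [Q.star_star] using Q.star_antitone hxy
    have ss : ∀ x y, Q.le (Q.star x) (Q.star y) → Q.le y x := fun x y hxy => by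
      simpa only [Q.star_star] using Q.star_antitone hxy
    refine h ⟨hs, ?_⟩
    rintro x (rfl | rfl) y (rfl | rfl)
    · exact ⟨h1, h2⟩
    · exact ⟨fun e => h4 (ts _ _ e), fun e => h3 (st _ _ e)⟩
    · exact ⟨h3, h4⟩
    · exact ⟨fun e => h2 (ss _ _ e), fun e => h1 (ss _ _ e)⟩
  rcases key with h | h | h | h
  · exact Or.inr (Or.inl ⟨h, fun e => hne e.symm⟩)
  · exact Or.inr (Or.inr (Or.inl ⟨h, hne⟩))
  · exact Or.inr (Or.inr (Or.inr (Or.inl ⟨h, fun e => hne' e.symm⟩)))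
  · exact Or.inr (Or.inr (Or.inr (Or.inr ⟨h, hne'⟩)))

theorem sameHyp_or_lt_of_sameHyp_map (hres : IsResolution Q Q' f) {a b : P}
    (h : Q'.sameHyp (f a) (f b)) :
    Q.sameHyp a b ∨ Q.lt a b ∨ Q.lt b a ∨ Q.lt (Q.star a) b ∨ Q.lt b (Q.star a) :=
  sameHyp_or_lt_of_not_transverse fun ht => (hres.adm.am2 _ _ ht).1 h

/-- Facing halfspaces with the same image under `f`, with no hyperplane of the same image
between them. -/
def FacingAdjacent (Q : Pocset P) (Q' : Pocset P') (f : P → P') (a b : P) : Prop :=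
  f a = f b ∧ Q.facing a b ∧
    ∀ m, Q'.sameHyp (f a) (f m) → Q.lt (Q.star a) m → ¬ Q.lt m b

theorem sameHyp_star {a b : P} (h : Q.sameHyp a b) : Q.sameHyp a (Q.star b) := by
  rcases h with rfl | rfl
  · exact Or.inr rfl
  · exact Or.inl (Q.star_star _)

theorem FacingAdjacent.symm (hf : ∀ h, f (Q.star h) = Q'.star (f h)) {a b : P}
    (h : FacingAdjacent Q Q' f a b) : FacingAdjacent Q Q' f b a := by
  refine ⟨h.1.symm, h.2.1.symm, fun m hm h1 h2 => h.2.2 (Q.star m) ?_ h2.star ?_⟩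
  · rw [hf, h.1]
    exact sameHyp_star hm
  · simpa only [Q.star_star] using h1.star

theorem not_lt_of_facing {a c : P} (h : Q.facing a c) : ¬ Q.lt a c := fun h' =>
  Q.not_star_le c (h.symm.trans h').1

theorem sameHyp_map_star (hres : IsResolution Q Q' f) {a b : P} (h : f a = f b) :
    Q'.sameHyp (f a) (f (Q.star b)) :=
  Or.inr (by rw [hres.adm.am1, h])

/-- As `G` acts without inversion on `P'`, an orbit does not contain a halfspace together with
its complement. -/
theorem star_notMem_orbit {G : Type w} [Group G] [MulAction G P'] (hG' : Q'.IsGAction G)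
    (hres : IsResolution Q Q' f) {a : P} {x : P'} (ha : f a ∈ MulAction.orbit G x) :
    f (Q.star a) ∉ MulAction.orbit G x := fun hs => by
  rw [← MulAction.orbit_eq_iff.2 ha, hres.adm.am1] at hs
  obtain ⟨g, hg⟩ := hs
  exact hG'.no_inversion g (f a) hg

theorem FacingAdjacent.trans (hres : IsResolution Q Q' f) {a b c : P}
    (hab : FacingAdjacent Q Q' f a b) (hbc : FacingAdjacent Q Q' f b c) (hne : a ≠ c) :
    FacingAdjacent Q Q' f a c := by
  have hba := hab.symm hres.adm.am1
  have hcb := hbc.symm hres.adm.am1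
  have hac : f a = f c := hab.1.trans hbc.1
  refine ⟨hac, ?_, fun m hm h1 h2 => ?_⟩
  · rcases sameHyp_or_lt_of_sameHyp_map hres (Or.inl hac.symm) with h | h | h | h | h
    · rcases h with h | h
      · exact absurd h.symm hne
      · exact absurd (by rw [h, hres.adm.am1] at hac; exact hac) (Q'.ne_star (f a))
    · exact absurd hab.2.1 (hcb.2.2 _ (sameHyp_map_star hres hac.symm) h.star)
    · exact absurd hcb.2.1 (hab.2.2 _ (sameHyp_map_star hres hac) h.star)
    · exact h
    · exact absurd (h.trans hab.2.1) (not_lt_of_facing hcb.2.1)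
  · have hm' : Q'.sameHyp (f b) (f m) := hab.1 ▸ hm
    have hms : Q.lt (Q.star c) (Q.star m) := h2.star
    have hma : Q.lt (Q.star m) a := by simpa only [Q.star_star] using h1.star
    rcases sameHyp_or_lt_of_sameHyp_map hres hm' with h | h | h | h | h
    · rcases h with rfl | rfl
      · exact not_lt_of_facing hbc.2.1 h2
      · rw [Q.star_star] at hma
        exact not_lt_of_facing hba.2.1 hma
    · exact not_lt_of_facing hbc.2.1 (h.trans h2)
    · exact hab.2.2 m hm h1 h
    · exact hcb.2.2 (Q.star m) (by
        rw [hres.adm.am1, ← hbc.1]; exact sameHyp_star hm') hms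
        (by simpa only [Q.star_star] using h.star)
    · exact not_lt_of_facing hba.2.1 (lt.trans (by simpa only [Q.star_star] using h.star) hma)

theorem FacingAdjacent.smul {G : Type w} [Group G] [MulAction G P] [MulAction G P']
    (hG : Q.IsGAction G) (hG' : Q'.IsGAction G) (hequi : Equivariant G f) (g : G) {a b : P}
    (h : FacingAdjacent Q Q' f a b) : FacingAdjacent Q Q' f (g • a) (g • b) := by
  have lt_smul : ∀ (g : G) {x y : P}, Q.lt x y → Q.lt (g • x) (g • y) := fun g x y hxy =>
    ⟨hG.smul_le g _ _ hxy.1, fun e => hxy.2 (smul_left_cancel g e)⟩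
  refine ⟨by rw [hequi, hequi, h.1], ?_, fun m hm h1 h2 => h.2.2 (g⁻¹ • m) ?_ ?_ ?_⟩
  · have := lt_smul g h.2.1
    rwa [hG.smul_star] at this
  · rw [hequi] at hm ⊢
    rcases hm with e | e
    · exact Or.inl (by rw [e, inv_smul_smul])
    · exact Or.inr (by rw [e, hG'.smul_star, inv_smul_smul])
  · have := lt_smul g⁻¹ h1
    rwa [← hG.smul_star, inv_smul_smul] at this
  · have := lt_smul g⁻¹ h2
    rwa [inv_smul_smul] at this

/-- The fold relation of an elementary foldable pair only relates halfspaces that are equal or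
facing adjacent, after reversing both when it is their complements that lie over the orbit of
`f h₁`. -/
theorem IsFoldRel.eq_or_facingAdjacent {G : Type w} [Group G] [MulAction G P] [MulAction G P']
    (hG : Q.IsGAction G) (hG' : Q'.IsGAction G) (hres : IsResolution Q Q' f)
    (hequi : Equivariant G f) {h₁ h₂ : P} (hfold : ElemFoldable Q Q' f h₁ h₂)
    {r : P → P → Prop} (hrel : Q.IsFoldRel G h₁ h₂ r) {a b : P} (hab : r a b) :
    a = b ∨ (f a ∈ MulAction.orbit G (f h₁) ∧ FacingAdjacent Q Q' f a b) ∨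
      (f (Q.star a) ∈ MulAction.orbit G (f h₁) ∧
        FacingAdjacent Q Q' f (Q.star a) (Q.star b)) := by
  have star_inj : ∀ {x y : P}, Q.star x = Q.star y → x = y := fun {x y} e => by
    rw [← Q.star_star x, e, Q.star_star]
  refine hrel.min (fun a b => a = b ∨ (f a ∈ MulAction.orbit G (f h₁) ∧
    FacingAdjacent Q Q' f a b) ∨ (f (Q.star a) ∈ MulAction.orbit G (f h₁) ∧
    FacingAdjacent Q Q' f (Q.star a) (Q.star b))) ⟨fun a => Or.inl rfl, ?_, ?_⟩ ?_ ?_ ?_ a b hab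
  · rintro x y (rfl | ⟨hx, h⟩ | ⟨hx, h⟩)
    · exact Or.inl rfl
    · exact Or.inr (Or.inl ⟨h.1 ▸ hx, h.symm hres.adm.am1⟩)
    · exact Or.inr (Or.inr ⟨h.1 ▸ hx, h.symm hres.adm.am1⟩)
  · rintro x y z (rfl | ⟨hx, h⟩ | ⟨hx, h⟩) h'
    · exact h'
    · rcases h' with rfl | ⟨-, h'⟩ | ⟨hy, -⟩
      · exact Or.inr (Or.inl ⟨hx, h⟩)
      · exact or_iff_not_imp_left.2 fun hne => Or.inl ⟨hx, h.trans hres h' hne⟩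
      · exact absurd hy (star_notMem_orbit hG' hres (h.1 ▸ hx))
    · rcases h' with rfl | ⟨hy, -⟩ | ⟨-, h'⟩
      · exact Or.inr (Or.inr ⟨hx, h⟩)
      · exact absurd (h.1 ▸ hx) (star_notMem_orbit hG' hres hy)
      · exact or_iff_not_imp_left.2 fun hne =>
          Or.inr ⟨hx, h.trans hres h' fun e => hne (star_inj e)⟩
  · rintro g x y (rfl | ⟨hx, h⟩ | ⟨hx, h⟩)
    · exact Or.inl rfl
    · refine Or.inr (Or.inl ⟨?_, h.smul hG hG' hequi g⟩)
      rw [hequi]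
      exact MulAction.mem_orbit_of_mem_orbit g hx
    · refine Or.inr (Or.inr ⟨?_, ?_⟩)
      · rw [← hG.smul_star, hequi]
        exact MulAction.mem_orbit_of_mem_orbit g hx
      · rw [← hG.smul_star, ← hG.smul_star]
        exact h.smul hG hG' hequi g
  · rintro x y (rfl | h | h)
    · exact Or.inl rfl
    · exact Or.inr (Or.inr (by simpa only [Q.star_star] using h))
    · exact Or.inr (Or.inl h)
  · refine Or.inr (Or.inl ⟨MulAction.mem_orbit_self _, hfold.2.1, hfold.1, fun m hm h1 h2 => ?_⟩)
    refine hfold.2.2.1 m ?_ ⟨_, Or.inr rfl, m, Or.inl rfl, h₂, Or.inl rfl, h1, h2⟩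
    rcases hm with e | e
    · exact Or.inl e.symm
    · exact Or.inr (by rw [e, Q'.star_star])

end Pocset

/-- for the elementary fold relation `∼` generated by an
elementary foldable pair, every class of hyperplanes `[ĥ]` has a choice of
orientation (a class of halfspaces `[a]` with `a` an orientation of `ĥ`)
whose halfspaces are pairwise facing; in particular `[ĥ]` is a facing
collection of hyperplanes. -/
theorem fold_class_is_facing {P : Type u} {P' : Type v}
    (Q : Pocset P) (Q' : Pocset P')
    (hLF : Q.LocallyFinite) (hLF' : Q'.LocallyFinite)
    (G : Type w) [Group G] [MulAction G P] [MulAction G P']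
    (hG : Q.IsGAction G) (hG' : Q'.IsGAction G)
    (f : P → P') (hres : Pocset.IsResolution Q Q' f)
    (hequi : Pocset.Equivariant G f)
    (h₁ h₂ : P) (hfold : Pocset.ElemFoldable Q Q' f h₁ h₂)
    (r : P → P → Prop) (hrel : Q.IsFoldRel G h₁ h₂ r) (h : P) :
    ∃ a ∈ Q.orient h, ∀ b c : P, r a b → r a c → ¬ Q.sameHyp b c → Q.facing b c := by
  have key := fun {b c} => hrel.eq_or_facingAdjacent (a := b) (b := c) hG hG' hres hequi hfold
  have main : ∀ a, f a ∈ MulAction.orbit G (f h₁) →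
      ∀ b c : P, r a b → r a c → ¬ Q.sameHyp b c → Q.facing b c := by
    intro a ha b c hab hac hbc
    have hb : f b ∈ MulAction.orbit G (f h₁) := by
      rcases key hab with rfl | ⟨-, h⟩ | ⟨hs, -⟩
      · exact ha
      · exact h.1 ▸ ha
      · exact absurd hs (Pocset.star_notMem_orbit hG' hres ha)
    rcases key (hrel.equiv.trans (hrel.equiv.symm hab) hac) with rfl | ⟨-, h⟩ | ⟨hs, -⟩
    · exact absurd (Or.inl rfl) hbc
    · exact h.2.1
    · exact absurd hs (Pocset.star_notMem_orbit hG' hres hb)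
  by_cases hs : f (Q.star h) ∈ MulAction.orbit G (f h₁)
  · exact ⟨_, Or.inr rfl, main _ hs⟩
  by_cases hh : f h ∈ MulAction.orbit G (f h₁)
  · exact ⟨_, Or.inl rfl, main _ hh⟩
  refine ⟨h, Or.inl rfl, fun b c hb hc hbc => ?_⟩
  have triv : ∀ x, r h x → h = x := fun x hx => by
    rcases key hx with e | ⟨h', -⟩ | ⟨h', -⟩
    · exact e
    · exact absurd h' hh
    · exact absurd h' hs
  exact absurd (Or.inl ((triv c hc).symm.trans (triv b hb))) hbc
end

section
/- Let a group G act without inversion on locally finite pocsets P and P', let f : P → P' be a G-equivariant resolution of pocsets, let h₁, h₂ ∈ P be an elementary foldable pair for f, and let ∼ be the smallest G-invariant and *-invariant equivalence relation on P with h₁ ∼ h₂. Then ∼ is an admissible equivalence relation on P. -/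
/- Pocsets, hyperplanes, admissible equivalence relations, quotients,
   admissible maps, embeddings, resolutions, group actions on pocsets,
   elementary folds and folding sequences. -/

universe u v w

namespace Pocset

variable {P : Type u} {P' : Type v}

theorem mem_orient {Q : Pocset P} {a h : P} : a ∈ Q.orient h ↔ a = h ∨ a = Q.star h := Iff.rfl

theorem orient_star (Q : Pocset P) (h : P) : Q.orient (Q.star h) = Q.orient h := by
  ext a
  rw [mem_orient, mem_orient, Q.star_star, or_comm]

theorem star_mem_orient {Q : Pocset P} {a h : P} (ha : a ∈ Q.orient h) :
    Q.star a ∈ Q.orient h := by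
  rcases ha with rfl | rfl
  · exact Or.inr rfl
  · exact Or.inl (Q.star_star h)

theorem orient_eq_of_mem {Q : Pocset P} {a h : P} (ha : a ∈ Q.orient h) :
    Q.orient a = Q.orient h := by
  rcases ha with rfl | rfl
  · rfl
  · exact Q.orient_star h

theorem lt_star {Q : Pocset P} {a b : P} (h : Q.lt a b) : Q.lt (Q.star b) (Q.star a) :=
  ⟨Q.star_antitone h.1, fun e => h.2 (by rw [← Q.star_star a, ← e, Q.star_star])⟩

theorem lt_trans {Q : Pocset P} {a b c : P} (hab : Q.lt a b) (hbc : Q.lt b c) : Q.lt a c :=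
  ⟨Q.le_trans hab.1 hbc.1, by rintro rfl; exact hab.2 (Q.le_antisymm hab.1 hbc.1)⟩

theorem separates_symm {Q : Pocset P} {m h k : P} (H : Q.separates m h k) :
    Q.separates m k h := by
  obtain ⟨a, ha, b, hb, c, hc, hab, hbc⟩ := H
  exact ⟨_, star_mem_orient hc, _, star_mem_orient hb, _, star_mem_orient ha,
    lt_star hbc, lt_star hab⟩

theorem not_separates_self (Q : Pocset P) (m h : P) : ¬ Q.separates m h h := by
  rintro ⟨a, ha, b, -, c, hc, hab, hbc⟩
  have hac := lt_trans hab hbc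
  rw [← orient_eq_of_mem ha] at hc
  rcases hc with rfl | rfl
  · exact hac.2 rfl
  · exact Q.not_le_star _ hac.1

theorem separates_star_star {Q : Pocset P} {m h k : P} :
    Q.separates m (Q.star h) (Q.star k) ↔ Q.separates m h k := by
  simp only [separates, orient_star]

theorem separates_star_right {Q : Pocset P} {m h k : P} :
    Q.separates m h (Q.star k) ↔ Q.separates m h k := by
  simp only [separates, orient_star]

/-- A hyperplane `b̂` disjoint from `m̂` lies on one side of `m̂`. -/
theorem separates_or_separates {Q : Pocset P} {m a b c : P} (H : Q.separates m a c)
    (hd : Q.disjointHyp m b) : Q.separates m a b ∨ Q.separates m b c := by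
  obtain ⟨a', ha, m', hm, c', hc, ham, hmc⟩ := H
  have hne : ∀ x ∈ Q.orient m, ∀ y ∈ Q.orient b, x ≠ y := by
    rintro x hx _ hy rfl
    refine hd.1 ?_
    have hb : b ∈ Q.orient b := Or.inl rfl
    rw [← orient_eq_of_mem hy, orient_eq_of_mem hx] at hb
    exact hb
  have hcomp : ∃ x ∈ Q.orient m, ∃ y ∈ Q.orient b, Q.lt x y ∨ Q.lt y x := by
    by_contra! hcon
    refine hd.2 ⟨hd.1, fun x hx y hy => ⟨fun h => ?_, fun h => ?_⟩⟩
    · exact (hcon x hx y hy).1 ⟨h, hne x hx y hy⟩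
    · exact (hcon x hx y hy).2 ⟨h, (hne x hx y hy).symm⟩
  obtain ⟨x, hx, y, hy, hxy⟩ := hcomp
  have hy' := star_mem_orient hy
  rw [← orient_eq_of_mem hm] at hx
  rcases hx with rfl | rfl
  · rcases hxy with h | h
    · exact Or.inl ⟨a', ha, _, hm, y, hy, ham, h⟩
    · exact Or.inr ⟨y, hy, _, hm, c', hc, h, hmc⟩
  · rcases hxy with h | h
    · have h' := lt_star h
      rw [Q.star_star] at h'
      exact Or.inr ⟨_, hy', _, hm, c', hc, h', hmc⟩
    · have h' := lt_star h
      rw [Q.star_star] at h'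
      exact Or.inl ⟨a', ha, _, hm, _, hy', ham, h'⟩

theorem IsGAction.smul_orient {Q : Pocset P} {G : Type w} [Group G] [MulAction G P]
    (hG : Q.IsGAction G) (g : G) {a h : P} (ha : a ∈ Q.orient h) : g • a ∈ Q.orient (g • h) := by
  rcases ha with rfl | rfl
  · exact Or.inl rfl
  · exact Or.inr (hG.smul_star g h)

theorem IsGAction.smul_lt {Q : Pocset P} {G : Type w} [Group G] [MulAction G P]
    (hG : Q.IsGAction G) (g : G) {a b : P} (hab : Q.lt a b) : Q.lt (g • a) (g • b) :=
  ⟨hG.smul_le g a b hab.1, fun e => hab.2 (MulAction.injective g e)⟩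

theorem IsGAction.smul_separates {Q : Pocset P} {G : Type w} [Group G] [MulAction G P]
    (hG : Q.IsGAction G) (g : G) {m h k : P} (H : Q.separates m h k) :
    Q.separates (g • m) (g • h) (g • k) := by
  obtain ⟨a, ha, b, hb, c, hc, hab, hbc⟩ := H
  exact ⟨_, hG.smul_orient g ha, _, hG.smul_orient g hb, _, hG.smul_orient g hc,
    hG.smul_lt g hab, hG.smul_lt g hbc⟩

/-- Invariance of `hypRel` under a change of orientation of either hyperplane. -/
theorem hypRel_of_mem_orient {Q : Pocset P} {r : P → P → Prop}
    (sinv : ∀ a b, r a b → r (Q.star a) (Q.star b)) {h k a b : P} (H : Q.hypRel r h k)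
    (ha : a ∈ Q.orient h) (hb : b ∈ Q.orient k) : Q.hypRel r a b := by
  have hstar : Q.hypRel r (Q.star h) k := by
    rcases H with H | H
    · exact Or.inr (sinv _ _ H)
    · have := sinv _ _ H
      rw [Q.star_star] at this
      exact Or.inl this
  have hak : Q.hypRel r a k := by
    rcases ha with rfl | rfl <;> assumption
  rcases hb with rfl | rfl
  · exact hak
  · unfold hypRel at hak ⊢
    rw [Q.star_star]
    exact hak.symm

theorem hypRel_trans_left {Q : Pocset P} {r : P → P → Prop} (hr : Equivalence r) {a b m : P}
    (hab : r a b) (H : Q.hypRel r b m) : Q.hypRel r a m :=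
  H.imp (hr.trans hab) (hr.trans hab)

theorem IsAdmissibleMap.hypRel_simRel_iff {Q : Pocset P} {Q' : Pocset P'} {f : P → P'}
    (hf : IsAdmissibleMap Q Q' f) {h m : P} :
    Q.hypRel (simRel f) h m ↔ Q'.sameHyp (f m) (f h) := by
  simp only [hypRel, simRel, sameHyp, hf.am1]

theorem IsFoldRel.simRel_of_rel {Q : Pocset P} {Q' : Pocset P'} {G : Type w} [Group G]
    [MulAction G P] [MulAction G P'] {f : P → P'} (hf : IsAdmissibleMap Q Q' f)
    (hequi : Equivariant G f) {h₁ h₂ : P} (hbase : f h₁ = f h₂) {r : P → P → Prop}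
    (hrel : Q.IsFoldRel G h₁ h₂ r) {a b : P} (hab : r a b) : f a = f b := by
  refine hrel.min (simRel f) ⟨fun _ => rfl, Eq.symm, Eq.trans⟩ (fun g x y hxy => ?_)
    (fun x y hxy => ?_) hbase a b hab
  · exact (hequi g x).trans ((congrArg (g • ·) hxy).trans (hequi g y).symm)
  · exact (hf.am1 x).trans ((congrArg Q'.star hxy).trans (hf.am1 y).symm)

/-- Every hyperplane of a fibre of `f` that separates two fold-equivalent hyperplanes of this
fibre is itself fold-equivalent to them. -/
theorem IsFoldRel.hypRel_of_separates {Q : Pocset P} {Q' : Pocset P'} {G : Type w} [Group G]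
    [MulAction G P] [MulAction G P'] (hG : Q.IsGAction G) {f : P → P'}
    (hf : IsAdmissibleMap Q Q' f) (hequi : Equivariant G f) {h₁ h₂ : P}
    (hbase : f h₁ = f h₂)
    (hinsep : ∀ m, Q'.sameHyp (f m) (f h₁) → ¬ Q.separates m h₁ h₂) {r : P → P → Prop}
    (hrel : Q.IsFoldRel G h₁ h₂ r) {a b : P} (hab : r a b) {m : P}
    (hm : Q.hypRel (simRel f) a m) (hsep : Q.separates m a b) : Q.hypRel r a m := by
  have hrf : ∀ {x y}, r x y → f x = f y := hrel.simRel_of_rel hf hequi hbase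
  have hfs : ∀ x y, simRel f x y → simRel f (Q.star x) (Q.star y) := fun x y hxy =>
    (hf.am1 x).trans ((congrArg Q'.star hxy).trans (hf.am1 y).symm)
  have hfe : Equivalence (simRel f) := ⟨fun _ => rfl, Eq.symm, Eq.trans⟩
  have hfg : ∀ (g : G) x y, Q.hypRel (simRel f) x y → Q.hypRel (simRel f) (g • x) (g • y) := by
    intro g x y hxy
    refine hxy.imp (fun h => ?_) (fun h => ?_)
    · exact (hequi g x).trans ((congrArg (g • ·) h).trans (hequi g y).symm)
    · rw [← hG.smul_star]
      exact (hequi g x).trans ((congrArg (g • ·) h).trans (hequi g _).symm)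
  refine (hrel.min (fun x y => r x y ∧ ∀ m, Q.hypRel (simRel f) x m → Q.separates m x y →
    Q.hypRel r x m) ⟨fun x => ?_, ?_, ?_⟩ ?_ ?_ ?_ a b hab).2 m hm hsep
  · exact ⟨hrel.equiv.refl x, fun m _ h => (Q.not_separates_self m x h).elim⟩
  · rintro x y ⟨hxy, H⟩
    have hyx := hrel.equiv.symm hxy
    exact ⟨hyx, fun m hm h => hypRel_trans_left hrel.equiv hyx
      (H m (hypRel_trans_left hfe (hrf hxy) hm) (separates_symm h))⟩
  · rintro x y z ⟨hxy, H⟩ ⟨hyz, H'⟩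
    refine ⟨hrel.equiv.trans hxy hyz, fun m hm h => ?_⟩
    by_cases hmy : Q.sameHyp y m
    · exact hypRel_of_mem_orient hrel.sinv (Or.inl hxy) (Or.inl rfl) hmy
    have hym : Q.hypRel (simRel f) y m := hypRel_trans_left hfe (hrf hxy).symm hm
    have hd : Q.disjointHyp m y := by
      refine ⟨fun hs => hmy ?_, fun ht => (hf.am2 _ _ ht).1 (hf.hypRel_simRel_iff.1 hym)⟩
      rcases hs with rfl | rfl
      · exact Or.inl rfl
      · exact Or.inr (Q.star_star m).symm
    rcases separates_or_separates h hd with h | h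
    · exact H m hm h
    · exact hypRel_trans_left hrel.equiv hxy (H' m hym h)
  · rintro g x y ⟨hxy, H⟩
    refine ⟨hrel.ginv g x y hxy, fun m hm h => ?_⟩
    have hm' := hfg g⁻¹ _ _ hm
    have h' := hG.smul_separates g⁻¹ h
    rw [inv_smul_smul] at hm' h'
    rw [inv_smul_smul] at h'
    have key := (H _ hm' h').imp (hrel.ginv g _ _) (hrel.ginv g _ _)
    rwa [hG.smul_star, smul_inv_smul] at key
  · rintro x y ⟨hxy, H⟩
    refine ⟨hrel.sinv x y hxy, fun m hm h => ?_⟩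
    exact hypRel_of_mem_orient hrel.sinv (H m
      (hypRel_of_mem_orient hfs hm (Or.inr (Q.star_star x).symm) (Or.inl rfl))
      (separates_star_star.1 h)) (Or.inr rfl) (Or.inl rfl)
  · exact ⟨hrel.base, fun m hm h => (hinsep m (hf.hypRel_simRel_iff.1 hm) h).elim⟩

end Pocset

/-- the elementary fold relation `∼` generated by an elementary
foldable pair is an admissible equivalence relation. -/
theorem fold_relation_is_admissible {P : Type u} {P' : Type v}
    (Q : Pocset P) (Q' : Pocset P')
    (hLF : Q.LocallyFinite) (hLF' : Q'.LocallyFinite)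
    (G : Type w) [Group G] [MulAction G P] [MulAction G P']
    (hG : Q.IsGAction G) (hG' : Q'.IsGAction G)
    (f : P → P') (hres : Pocset.IsResolution Q Q' f)
    (hequi : Pocset.Equivariant G f)
    (h₁ h₂ : P) (hfold : Pocset.ElemFoldable Q Q' f h₁ h₂)
    (r : P → P → Prop) (hrel : Q.IsFoldRel G h₁ h₂ r) :
    Q.IsAdmissible r := by
  have hf := hres.adm
  obtain ⟨-, hbase, hinsep, -⟩ := hfold
  have hrf : ∀ {a b}, r a b → f a = f b := hrel.simRel_of_rel hf hequi hbase
  refine ⟨hrel.equiv, fun h hh => hres.aer.aer1 h (hrf hh), hrel.sinv,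
    fun h k ht hhk => hres.aer.aer3 h k ht (hrf hhk), ?_⟩
  intro h k hhk hne hsep a ha b hb hab
  have hfab : f a = f b := by
    refine hres.aer.aer4 h k (hhk.imp hrf hrf) hne (fun m hm hs => ?_) a ha b hb hab
    refine hsep m ?_ hs
    rcases hhk with hhk | hhk
    · exact hrel.hypRel_of_separates hG hf hequi hbase hinsep hhk hm hs
    · exact hrel.hypRel_of_separates hG hf hequi hbase hinsep hhk hm
        (Pocset.separates_star_right.2 hs)
  rcases Pocset.hypRel_of_mem_orient hrel.sinv hhk ha hb with h' | h'
  · exact h'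
  · exact (hres.aer.aer1 b (hfab.symm.trans (hrf h'))).elim
end
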